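/- Let v ∈ ℝ³ be a unit vector with ⟨v, e₁⟩ ≠ 0 (i.e. v does not lie in the plane {x = 0}), let (a, b, v) be an orthonormal basis of ℝ³, and let Σ = {s·a + t·b + u(s,t)·v : (s,t) ∈ Ω} be a complete connected translating graph in the direction v. If Σ is contained in a slab {(x,y,z) : |x| ≤ w} for some w > 0, then Σ is a vertical plane: there exists x₀ ∈ ℝ with Σ = {(x₀, y, z) : y, z ∈ ℝ}. -/

import Mathlib

open MeasureTheory Metric Real EuclideanSpace
open scoped RealInnerProductSpace ENNReal NNReal

noncomputable section

abbrev E3 : Type := EuclideanSpace ℝ (Fin 3)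

def e1 : E3 := EuclideanSpace.single 0 1
def e2 : E3 := EuclideanSpace.single 1 1
def e3 : E3 := EuclideanSpace.single 2 1

/-- First partial derivative of `u` in the first variable. -/
def pds (u : ℝ × ℝ → ℝ) (p : ℝ × ℝ) : ℝ := fderiv ℝ u p (1, 0)

/-- First partial derivative of `u` in the second variable. -/
def pdt (u : ℝ × ℝ → ℝ) (p : ℝ × ℝ) : ℝ := fderiv ℝ u p (0, 1)

/-- `S` is a translating graph in the direction of the unit vector `v`, with respect to the
orthonormal basis `(a, b, v)` of `ℝ³`, over the open connected domain `Ω ⊆ ℝ²`, given by the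
smooth function `u : Ω → ℝ` solving the translator equation. -/
structure IsTranslatingGraph (a b v : E3) (Ω : Set (ℝ × ℝ)) (u : ℝ × ℝ → ℝ)
    (S : Set E3) : Prop where
  norm_a : ‖a‖ = 1
  norm_b : ‖b‖ = 1
  norm_v : ‖v‖ = 1
  inner_ab : ⟪a, b⟫ = 0
  inner_av : ⟪a, v⟫ = 0
  inner_bv : ⟪b, v⟫ = 0
  isOpen_dom : IsOpen Ω
  isConnected_dom : IsConnected Ω
  smooth : ContDiffOn ℝ (⊤ : ℕ∞) u Ω
  pde : ∀ p ∈ Ω,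
    (1 + (pdt u p) ^ 2) * pds (fun q => pds u q) p
      - 2 * pds u p * pdt u p * pdt (fun q => pds u q) p
      + (1 + (pds u p) ^ 2) * pdt (fun q => pdt u q) p
    = (1 + (pds u p) ^ 2 + (pdt u p) ^ 2) *
        (⟪e3, v⟫ - pds u p * ⟪e3, a⟫ - pdt u p * ⟪e3, b⟫)
  graph_eq : S = {q : E3 | ∃ p ∈ Ω, q = p.1 • a + p.2 • b + u p • v}

/-- Entropy of a surface. -/
def entropy (S : Set E3) : ℝ≥0∞ :=
  ⨆ (x₀ : E3) (s₀ : ℝ) (_ : 0 < s₀),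
    (ENNReal.ofReal (4 * π * s₀))⁻¹ *
      ∫⁻ q in S, ENNReal.ofReal (Real.exp (-‖q - x₀‖ ^ 2 / (4 * s₀))) ∂(μH[2])

/-- Number of connected components (as a cardinal). -/
def numComponents (A : Set E3) : Cardinal := Cardinal.mk (ConnectedComponents A)

def vθ (θ : ℝ) : E3 := Real.sin θ • e3 + Real.cos θ • e2
def bθ (θ : ℝ) : E3 := Real.cos θ • e3 - Real.sin θ • e2


/-- The point of the translating graph over parameter `p`, for the basis `(e₁, b_θ, v_θ)`. -/
def graphPtθ (θ : ℝ) (u : ℝ × ℝ → ℝ) (p : ℝ × ℝ) : E3 :=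
  p.1 • e1 + p.2 • bθ θ + u p • vθ θ

/-- The Gauss map of a translating graph in the direction `v_θ`, as a function of the
parameter `p ∈ Ω`: `N = (v_θ − u_s e₁ − u_t b_θ)/√(1+u_s²+u_t²)`. -/
def gaussMapθ (θ : ℝ) (u : ℝ × ℝ → ℝ) (p : ℝ × ℝ) : E3 :=
  (Real.sqrt (1 + (pds u p) ^ 2 + (pdt u p) ^ 2))⁻¹ •
    (vθ θ - pds u p • e1 - pdt u p • bθ θ)

theorem touching_algebra {p q r s t a b c d W W1 W2 W11 W12 W22 e e1 e2 e11 e12 e22 b1 b2 g l1 l2 : ℝ}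
    (hW : 0 < W) (he : 0 < e)
    (hW0 : W * W = 1 + p * p + q * q)
    (hW1 : W * W1 = p * r + q * s) (hW2 : W * W2 = p * s + q * t)
    (hW11 : W1 * W1 + W * W11 = r * r + p * a + (s * s + q * b))
    (hW12 : W2 * W1 + W * W12 = s * r + p * b + (t * s + q * c))
    (hW22 : W2 * W2 + W * W22 = s * s + p * c + (t * t + q * d))
    (h0 : (1 + q ^ 2) * r - 2 * p * q * s + (1 + p ^ 2) * t
      = (1 + p ^ 2 + q ^ 2) * (g - p * b1 - q * b2))
    (hs : 2 * q * s * r + (1 + q ^ 2) * a - 2 * (r * q + p * s) * s - 2 * p * q * b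
        + 2 * p * r * t + (1 + p ^ 2) * c
      = 2 * (p * r + q * s) * (g - p * b1 - q * b2) - (1 + p ^ 2 + q ^ 2) * (r * b1 + s * b2))
    (ht : 2 * q * t * r + (1 + q ^ 2) * b - 2 * (s * q + p * t) * s - 2 * p * q * c
        + 2 * p * s * t + (1 + p ^ 2) * d
      = 2 * (p * s + q * t) * (g - p * b1 - q * b2) - (1 + p ^ 2 + q ^ 2) * (s * b1 + t * b2))
    (hf1 : l1 * r + l2 * s = e1 * W + e * W1) (hf2 : l1 * s + l2 * t = e2 * W + e * W2)
    (hf : 0 ≤ (1 + q ^ 2) * (l1 * a + l2 * b - (e11 * W + 2 * e1 * W1 + e * W11))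
      - 2 * p * q * (l1 * b + l2 * c - (e12 * W + e1 * W2 + e2 * W1 + e * W12))
      + (1 + p ^ 2) * (l1 * c + l2 * d - (e22 * W + 2 * e2 * W2 + e * W22))) :
    (1 + q ^ 2) * e11 - 2 * p * q * e12 + (1 + p ^ 2) * e22
      + (1 + p ^ 2 + q ^ 2) * (e1 * b1 + e2 * b2) ≤ 0 := by
  set X := (1 + q ^ 2) * e11 - 2 * p * q * e12 + (1 + p ^ 2) * e22
      + (1 + p ^ 2 + q ^ 2) * (e1 * b1 + e2 * b2) with hX
  set Q := r ^ 2 + 2 * s ^ 2 + t ^ 2 + 2 * ((q * r - p * s) ^ 2 + (q * s - p * t) ^ 2)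
    + (q ^ 2 * r - 2 * p * q * s + p ^ 2 * t) ^ 2 with hQ
  have hQ0 : 0 ≤ Q := by positivity
  set V := 1 + p ^ 2 + q ^ 2 with hV
  have hVW : W ^ 2 = V := by rw [hV]; linarith
  have hV0 : 0 < V := by positivity
  set K := g - p * b1 - q * b2
  have Bs : (1 + q ^ 2) * a - 2 * p * q * b + (1 + p ^ 2) * c =
      2 * W * W1 * K - 2 * p * (r * t - s ^ 2) - V * (r * b1 + s * b2) := by
    linear_combination hs - 2 * K * hW1
  have Bt : (1 + q ^ 2) * b - 2 * p * q * c + (1 + p ^ 2) * d =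
      2 * W * W2 * K - 2 * q * (r * t - s ^ 2) - V * (s * b1 + t * b2) := by
    linear_combination ht - 2 * K * hW2
  -- the linearised equation
  have Ls : V * ((1 + q ^ 2) * a - 2 * p * q * b + (1 + p ^ 2) * c + V * (r * b1 + s * b2)) =
      2 * W * ((1 + q ^ 2) * r * W1 - p * q * (r * W2 + s * W1) + (1 + p ^ 2) * s * W2) := by
    linear_combination V * Bs - 2 * W * W1 * h0 + (2 * ((1+q^2)*r - 2*p*q*s+(1+p^2)*t) - 2 * ((1+q^2)*r - p*q*s)) * hW1 - 2 * (-p*q*r + (1+p^2)*s) * hW2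
  have Lt : V * ((1 + q ^ 2) * b - 2 * p * q * c + (1 + p ^ 2) * d + V * (s * b1 + t * b2)) =
      2 * W * ((1 + q ^ 2) * s * W1 - p * q * (s * W2 + t * W1) + (1 + p ^ 2) * t * W2) := by
    linear_combination V * Bt - 2 * W * W2 * h0 + (2 * ((1+q^2)*r - 2*p*q*s+(1+p^2)*t) - 2 * (-p*q*s + (1+p^2)*t)) * hW2 - 2 * ((1+q^2)*s - p*q*t) * hW1
  have LW : W * V * ((1 + q ^ 2) * W11 - 2 * p * q * W12 + (1 + p ^ 2) * W22
      + V * (W1 * b1 + W2 * b2)) = Q + 2 * V * ((1 + q ^ 2) * W1 * W1 - 2 * p * q * W1 * W2 + (1 + p ^ 2) * W2 * W2) := by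
    linear_combination V * ((1 + q ^ 2) * hW11 - 2 * p * q * hW12 + (1 + p ^ 2) * hW22)
      + p * Ls + q * Lt + V ^ 2 * (b1 * hW1 + b2 * hW2)
      - 2 * W * ((1 + q ^ 2) * W1 - p * q * W2) * hW1 - 2 * W * ((1 + p ^ 2) * W2 - p * q * W1) * hW2
      + 2 * ((1 + q ^ 2) * W1 * W1 - 2 * p * q * W1 * W2 + (1 + p ^ 2) * W2 * W2) * hVW
      - ((1 + q ^ 2) * (W * W1 + p * r + q * s) - 2 * p * q * (p * s + q * t)) * hW1
      - ((1 + p ^ 2) * (W * W2 + p * s + q * t) - 2 * p * q * (W * W1)) * hW2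
      + ((1 + q ^ 2) * W1 * W1 - 2 * p * q * W1 * W2 + (1 + p ^ 2) * W2 * W2) * hVW
  have key : V * W * X * W ≤ - (e * Q) := by
    have h1 := mul_nonneg (mul_pos hV0 hW).le hf
    have h2 : V * W * ((1 + q ^ 2) * (l1 * a + l2 * b - (e11 * W + 2 * e1 * W1 + e * W11))
      - 2 * p * q * (l1 * b + l2 * c - (e12 * W + e1 * W2 + e2 * W1 + e * W12))
      + (1 + p ^ 2) * (l1 * c + l2 * d - (e22 * W + 2 * e2 * W2 + e * W22)))
      = - (V * W * X * W) - e * Q := by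
      linear_combination W * (l1 * Ls + l2 * Lt) - e * LW
        + (2 * W ^ 2 * ((1 + q ^ 2) * W1 - p * q * W2) - W * V ^ 2 * b1) * hf1
        + (2 * W ^ 2 * ((1 + p ^ 2) * W2 - p * q * W1) - W * V ^ 2 * b2) * hf2
        + 2 * (((1 + q ^ 2) * W1 - p * q * W2) * (e1 * W + e * W1)
          + ((1 + p ^ 2) * W2 - p * q * W1) * (e2 * W + e * W2)) * hVW
    linarith
  by_contra hcon
  push Not at hcon
  have : 0 < V * W * X * W := by positivity
  have : 0 ≤ e * Q := by positivity
  linarith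

/-- `f` is differentiable on the plane with first partial derivatives `f₁` and `f₂`. -/
def HasPartials (f f₁ f₂ : ℝ × ℝ → ℝ) : Prop :=
  ∀ x, HasFDerivAt f
    (f₁ x • ContinuousLinearMap.fst ℝ ℝ ℝ + f₂ x • ContinuousLinearMap.snd ℝ ℝ ℝ) x

namespace HasPartials

variable {f f₁ f₂ g g₁ g₂ : ℝ × ℝ → ℝ}

theorem const (c : ℝ) : HasPartials (fun _ => c) (fun _ => 0) (fun _ => 0) := fun x => by
  simpa using hasFDerivAt_const c x

theorem fst : HasPartials (fun x => x.1) (fun _ => 1) (fun _ => 0) := fun x => by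
  simpa using hasFDerivAt_fst

theorem snd : HasPartials (fun x => x.2) (fun _ => 0) (fun _ => 1) := fun x => by
  simpa using hasFDerivAt_snd

theorem add (hf : HasPartials f f₁ f₂) (hg : HasPartials g g₁ g₂) :
    HasPartials (fun x => f x + g x) (fun x => f₁ x + g₁ x) (fun x => f₂ x + g₂ x) := fun x => by
  refine ((hf x).add (hg x)).congr_fderiv ?_
  ext <;> simp

theorem sub (hf : HasPartials f f₁ f₂) (hg : HasPartials g g₁ g₂) :
    HasPartials (fun x => f x - g x) (fun x => f₁ x - g₁ x) (fun x => f₂ x - g₂ x) := fun x => by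
  refine ((hf x).sub (hg x)).congr_fderiv ?_
  ext <;> simp

theorem mul (hf : HasPartials f f₁ f₂) (hg : HasPartials g g₁ g₂) :
    HasPartials (fun x => f x * g x) (fun x => f₁ x * g x + f x * g₁ x)
      (fun x => f₂ x * g x + f x * g₂ x) := fun x => by
  refine ((hf x).mul (hg x)).congr_fderiv ?_
  ext <;> simp <;> ring

theorem const_mul (c : ℝ) (hf : HasPartials f f₁ f₂) :
    HasPartials (fun x => c * f x) (fun x => c * f₁ x) (fun x => c * f₂ x) := by
  simpa using (const c).mul hf

theorem unique (hf : HasPartials f f₁ f₂) (hg : HasPartials f g₁ g₂) (x : ℝ × ℝ) :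
    f₁ x = g₁ x ∧ f₂ x = g₂ x := by
  have h := (hf x).unique (hg x)
  exact ⟨by simpa using congrArg (fun L => L (1, 0)) h, by simpa using congrArg (fun L => L (0, 1)) h⟩

theorem eq_zero (hf : HasPartials f f₁ f₂) (h : ∀ y, f y = 0) (x : ℝ × ℝ) :
    f₁ x = 0 ∧ f₂ x = 0 := by
  obtain rfl : f = fun _ => 0 := funext h
  exact hf.unique (const 0) x

theorem continuous (hf : HasPartials f f₁ f₂) : Continuous f :=
  continuous_iff_continuousAt.2 fun x => (hf x).continuousAt

theorem hasDerivAt_line (hf : HasPartials f f₁ f₂) (x d : ℝ × ℝ) (τ : ℝ) :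
    HasDerivAt (fun τ : ℝ => f (x + τ • d)) (f₁ (x + τ • d) * d.1 + f₂ (x + τ • d) * d.2) τ := by
  have h : HasDerivAt (fun τ : ℝ => x + τ • d) d τ := by
    simpa using ((hasDerivAt_id τ).smul_const d).const_add x
  have := (hf (x + τ • d)).comp_hasDerivAt τ h
  simp only [_root_.add_apply, _root_.smul_apply,
    ContinuousLinearMap.coe_fst', ContinuousLinearMap.coe_snd', smul_eq_mul] at this
  exact this

end HasPartials

theorem hasPartials_of_contDiff {f : ℝ × ℝ → ℝ} (hf : ContDiff ℝ (⊤ : ℕ∞) f) :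
    HasPartials f (pds f) (pdt f) := fun x => by
  refine ((hf.differentiable (by simp)) x).hasFDerivAt.congr_fderiv ?_
  ext <;> simp [pds, pdt]

theorem contDiff_pds {f : ℝ × ℝ → ℝ} (hf : ContDiff ℝ (⊤ : ℕ∞) f) :
    ContDiff ℝ (⊤ : ℕ∞) (pds f) :=
  (hf.fderiv_right (m := (⊤ : ℕ∞)) (by simp)).clm_apply contDiff_const

theorem contDiff_pdt {f : ℝ × ℝ → ℝ} (hf : ContDiff ℝ (⊤ : ℕ∞) f) :
    ContDiff ℝ (⊤ : ℕ∞) (pdt f) :=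
  (hf.fderiv_right (m := (⊤ : ℕ∞)) (by simp)).clm_apply contDiff_const

theorem pds_pdt_comm {f : ℝ × ℝ → ℝ} (hf : ContDiff ℝ (⊤ : ℕ∞) f) :
    pds (pdt f) = pdt (pds f) := by
  ext x
  have hd : DifferentiableAt ℝ (fderiv ℝ f) x :=
    ((hf.fderiv_right (m := (⊤ : ℕ∞)) (by simp)).differentiable (by simp)) x
  have h : ∀ v w : ℝ × ℝ, fderiv ℝ (fun y => fderiv ℝ f y v) x w = fderiv ℝ (fderiv ℝ f) x w v := by
    intro v w
    rw [fderiv_clm_apply hd (differentiableAt_const v)]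
    simp
  have hs : IsSymmSndFDerivAt ℝ f x := hf.contDiffAt.isSymmSndFDerivAt (by
    rw [minSmoothness_of_isRCLikeNormedField]
    exact WithTop.coe_le_coe.2 (le_top : (2 : ℕ∞) ≤ ⊤))
  change fderiv ℝ (fun y => fderiv ℝ f y (0, 1)) x (1, 0)
    = fderiv ℝ (fun y => fderiv ℝ f y (1, 0)) x (0, 1)
  rw [h, h]
  exact hs _ _

/-- Second derivative test: the second derivative is nonnegative at a local minimum. -/
theorem IsLocalMin.secondDeriv_nonneg {f f' : ℝ → ℝ} {x₀ c : ℝ} (h : IsLocalMin f x₀)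
    (hf : ∀ x, HasDerivAt f (f' x) x) (hf' : HasDerivAt f' c x₀) : 0 ≤ c := by
  by_contra! hc
  have hd : deriv f = f' := funext fun x => (hf x).deriv
  have h0 : f' x₀ = 0 := h.hasDerivAt_eq_zero (hf x₀)
  have hmax : IsLocalMax f x₀ := isLocalMax_of_deriv_deriv_neg (by rw [hd, hf'.deriv]; exact hc)
    (by rw [hd, h0]) (hf x₀).continuousAt
  have hconst : f =ᶠ[nhds x₀] fun _ => f x₀ := by
    filter_upwards [h, hmax] with x h₁ h₂ using le_antisymm h₂ h₁
  have hzero : f' =ᶠ[nhds x₀] fun _ => 0 := by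
    have := hconst.deriv
    rw [hd] at this
    simpa using this
  have := hf'.unique ((hasDerivAt_const x₀ (0 : ℝ)).congr_of_eventuallyEq hzero)
  linarith

/-- Necessary conditions for a local minimum of a function of two variables. -/
theorem HasPartials.of_isLocalMin {f f₁ f₂ f₁₁ f₁₂ f₂₁ f₂₂ : ℝ × ℝ → ℝ} (hf : HasPartials f f₁ f₂)
    (hf₁ : HasPartials f₁ f₁₁ f₁₂) (hf₂ : HasPartials f₂ f₂₁ f₂₂) {x : ℝ × ℝ}
    (h : IsLocalMin f x) :
    f₁ x = 0 ∧ f₂ x = 0 ∧ ∀ d₁ d₂ : ℝ,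
      0 ≤ d₁ ^ 2 * f₁₁ x + d₁ * d₂ * (f₁₂ x + f₂₁ x) + d₂ ^ 2 * f₂₂ x := by
  have h0 := h.hasFDerivAt_eq_zero (hf x)
  refine ⟨by simpa using congrArg (fun L => L (1, 0)) h0,
    by simpa using congrArg (fun L => L (0, 1)) h0, fun d₁ d₂ => ?_⟩
  have hline : IsLocalMin (fun τ : ℝ => f (x + τ • (d₁, d₂))) 0 := by
    have hc : Filter.Tendsto (fun τ : ℝ => x + τ • (d₁, d₂)) (nhds 0) (nhds x) := by
      have : Continuous (fun τ : ℝ => x + τ • (d₁, d₂)) := by fun_prop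
      simpa using this.tendsto 0
    have := hc.eventually h
    simpa [IsLocalMin, IsMinFilter] using this
  have := hline.secondDeriv_nonneg (hf.hasDerivAt_line x (d₁, d₂))
    (((hf₁.hasDerivAt_line x (d₁, d₂) 0).mul_const d₁).add
      ((hf₂.hasDerivAt_line x (d₁, d₂) 0).mul_const d₂))
  simp only [zero_smul, add_zero] at this
  linarith

theorem touching {u : ℝ × ℝ → ℝ} (hu : ContDiff ℝ (⊤ : ℕ∞) u) {b₁ b₂ g : ℝ}
    (pde : ∀ x, (1 + (pdt u x) ^ 2) * pds (pds u) x - 2 * pds u x * pdt u x * pdt (pds u) x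
      + (1 + (pds u x) ^ 2) * pdt (pdt u) x
      = (1 + (pds u x) ^ 2 + (pdt u x) ^ 2) * (g - pds u x * b₁ - pdt u x * b₂))
    {e e₁ e₂ e₁₁ e₁₂ e₂₂ : ℝ × ℝ → ℝ} (he : HasPartials e e₁ e₂)
    (he₁ : HasPartials e₁ e₁₁ e₁₂) (he₂ : HasPartials e₂ e₁₂ e₂₂) {l₀ l₁ l₂ : ℝ} {x : ℝ × ℝ}
    (hpos : 0 < e x)
    (hmin : IsLocalMin (fun y => l₀ + l₁ * pds u y + l₂ * pdt u y
      - e y * √(1 + (pds u y) ^ 2 + (pdt u y) ^ 2)) x) :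
    (1 + (pdt u x) ^ 2) * e₁₁ x - 2 * pds u x * pdt u x * e₁₂ x + (1 + (pds u x) ^ 2) * e₂₂ x
      + (1 + (pds u x) ^ 2 + (pdt u x) ^ 2) * (e₁ x * b₁ + e₂ x * b₂) ≤ 0 := by
  have hp := contDiff_pds hu
  have hq := contDiff_pdt hu
  have hr := contDiff_pds hp
  have hs := contDiff_pdt hp
  have ht := contDiff_pdt hq
  have Hp := hasPartials_of_contDiff hp
  have Hq := hasPartials_of_contDiff hq
  have Hr := hasPartials_of_contDiff hr
  have Hs := hasPartials_of_contDiff hs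
  have Ht := hasPartials_of_contDiff ht
  rw [pds_pdt_comm hu] at Hq
  rw [pds_pdt_comm hp] at Hs
  have hst : pds (pdt (pdt u)) = pdt (pdt (pds u)) := by
    rw [pds_pdt_comm hq, pds_pdt_comm hu]
  rw [hst] at Ht
  set W : ℝ × ℝ → ℝ := fun y => √(1 + (pds u y) ^ 2 + (pdt u y) ^ 2) with hW
  have hWs : ContDiff ℝ (⊤ : ℕ∞) W :=
    ((contDiff_const.add (hp.pow 2)).add (hq.pow 2)).sqrt fun y => by positivity
  have HW := hasPartials_of_contDiff hWs
  have HW₁ := hasPartials_of_contDiff (contDiff_pds hWs)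
  have HW₂ := hasPartials_of_contDiff (contDiff_pdt hWs)
  rw [pds_pdt_comm hWs] at HW₂
  set p := pds u
  set q := pdt u
  set r := pds p
  set s := pdt p
  set t := pdt q
  have hWsq : ∀ y, W y * W y = 1 + p y * p y + q y * q y := fun y => by
    rw [hW]; dsimp only; rw [Real.mul_self_sqrt (by positivity)]; ring
  have hW1 : ∀ y, W y * pds W y = p y * r y + q y * s y ∧
      W y * pdt W y = p y * s y + q y * t y := by
    intro y
    have := ((HW.mul HW).sub (((HasPartials.const 1).add (Hp.mul Hp)).add (Hq.mul Hq))).eq_zero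
      (fun y => by linarith [hWsq y]) y
    constructor <;> linarith [this.1, this.2]
  have hW11 := ((HW.mul HW₁).sub ((Hp.mul Hr).add (Hq.mul Hs))).eq_zero
    (fun y => by linarith [(hW1 y).1]) x
  have hW22 := ((HW.mul HW₂).sub ((Hp.mul Hs).add (Hq.mul Ht))).eq_zero
    (fun y => by linarith [(hW1 y).2]) x
  have C1 := HasPartials.const 1
  have hpde := (((((C1.add (Hq.mul Hq)).mul Hr).sub ((((Hp.mul Hq).const_mul 2)).mul Hs)).add
    ((C1.add (Hp.mul Hp)).mul Ht)).sub (((C1.add (Hp.mul Hp)).add (Hq.mul Hq)).mul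
      (((HasPartials.const g).sub (Hp.mul (HasPartials.const b₁))).sub
        (Hq.mul (HasPartials.const b₂))))).eq_zero (fun y => by linarith [pde y]) x
  have Hf := (((HasPartials.const l₀).add (Hp.const_mul l₁)).add (Hq.const_mul l₂)).sub (he.mul HW)
  have Hf₁ := (((HasPartials.const 0).add (Hr.const_mul l₁)).add (Hs.const_mul l₂)).sub
    ((he₁.mul HW).add (he.mul HW₁))
  have Hf₂ := (((HasPartials.const 0).add (Hs.const_mul l₁)).add (Ht.const_mul l₂)).sub
    ((he₂.mul HW).add (he.mul HW₂))
  obtain ⟨h1, h2, h3⟩ := Hf.of_isLocalMin Hf₁ Hf₂ hmin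
  have hW0 : 0 < W x := Real.sqrt_pos.2 (by positivity)
  refine touching_algebra (W := W x) (W1 := pds W x) (W2 := pdt W x) (W11 := pds (pds W) x)
    (W12 := pdt (pds W) x) (W22 := pdt (pdt W) x) (r := r x) (s := s x) (t := t x)
    (a := pds r x) (b := pdt r x) (c := pdt s x) (d := pdt t x) (e := e x) (g := g)
    (l1 := l₁) (l2 := l₂) hW0 hpos (hWsq x) (hW1 x).1 (hW1 x).2 ?_ ?_ ?_ (pde x) ?_ ?_ ?_ ?_ ?_
  · linarith [hW11.1]
  · linarith [hW11.2]
  · linarith [hW22.2]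
  · linarith [hpde.1]
  · linarith [hpde.2]
  · linarith
  · linarith
  · linarith [h3 1 0, h3 0 1, h3 (q x) (-p x)]

theorem small_gradient_algebra {p q f ε μ x y h₁ h₂ b₁ b₂ : ℝ} (hε : 0 < ε) (hε' : ε ≤ 1)
    (hf : 0 < f) (hf' : f ≤ 3 / 2) (hb : b₁ ^ 2 + b₂ ^ 2 ≤ 1)
    (hxy : ε ^ 2 * (x ^ 2 + y ^ 2) ≤ 3 / 2)
    (h : (1 + q ^ 2) * (μ * h₁ - 2 * ε ^ 2 * x) ^ 2
      - 2 * p * q * (μ * h₁ - 2 * ε ^ 2 * x) * (μ * h₂ - 2 * ε ^ 2 * y)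
      + (1 + p ^ 2) * (μ * h₂ - 2 * ε ^ 2 * y) ^ 2
      ≤ f * (ε ^ 2 * (2 * (2 + p ^ 2 + q ^ 2) + 2 * (1 + p ^ 2 + q ^ 2) * (b₁ * x + b₂ * y)))) :
    μ ^ 2 * (h₁ ^ 2 + h₂ ^ 2 + (q * h₁ - p * h₂) ^ 2) ≤ 48 * ε * (1 + p ^ 2 + q ^ 2) := by
  set V := 1 + p ^ 2 + q ^ 2 with hV
  have hV1 : 1 ≤ V := by rw [hV]; nlinarith [sq_nonneg p, sq_nonneg q]
  have hbxy : ε * (b₁ * x + b₂ * y) ≤ 5 / 4 := by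
    refine abs_le_of_sq_le_sq' (b := 5 / 4) ?_ (by norm_num) |>.2
    have h1 : (b₁ * x + b₂ * y) ^ 2 ≤ x ^ 2 + y ^ 2 := by
      nlinarith [sq_nonneg (b₁ * y - b₂ * x), mul_nonneg (sub_nonneg.2 hb)
        (add_nonneg (sq_nonneg x) (sq_nonneg y))]
    nlinarith [mul_le_mul_of_nonneg_left h1 (sq_nonneg ε)]
  have hεε : ε ^ 2 ≤ ε := by nlinarith
  have hinner : ε ^ 2 * (2 * (2 + p ^ 2 + q ^ 2) + 2 * V * (b₁ * x + b₂ * y)) ≤ 13 / 2 * ε * V := by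
    have h1 : ε ^ 2 * (2 * (2 + p ^ 2 + q ^ 2)) ≤ ε * (4 * V) := by
      refine mul_le_mul hεε ?_ (by positivity) hε.le
      rw [hV]; nlinarith [sq_nonneg p, sq_nonneg q]
    have h2 := mul_le_mul_of_nonneg_left hbxy (by positivity : 0 ≤ 2 * ε * V)
    nlinarith
  have hG : (μ * h₁ - 2 * ε ^ 2 * x) ^ 2 + (μ * h₂ - 2 * ε ^ 2 * y) ^ 2
      + (q * (μ * h₁ - 2 * ε ^ 2 * x) - p * (μ * h₂ - 2 * ε ^ 2 * y)) ^ 2 ≤ 10 * ε * V := by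
    have h1 := mul_le_mul_of_nonneg_left hinner hf.le
    have h2 := mul_le_mul_of_nonneg_right hf' (by positivity : 0 ≤ 13 / 2 * ε * V)
    have h3 : 0 ≤ ε * V := by positivity
    nlinarith
  have hY : (2 * ε ^ 2 * x) ^ 2 + (2 * ε ^ 2 * y) ^ 2
      + (q * (2 * ε ^ 2 * x) - p * (2 * ε ^ 2 * y)) ^ 2 ≤ 6 * ε * V := by
    have h1 : x ^ 2 + y ^ 2 + (q * x - p * y) ^ 2 ≤ V * (x ^ 2 + y ^ 2) := by
      rw [hV]; nlinarith [sq_nonneg (p * x + q * y)]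
    have h2 := mul_le_mul_of_nonneg_left h1 (by positivity : 0 ≤ 4 * ε ^ 4)
    have h3 := mul_le_mul_of_nonneg_left hxy (by positivity : 0 ≤ 4 * ε ^ 2 * V)
    have h4 := mul_le_mul_of_nonneg_right hεε (by positivity : 0 ≤ 6 * V)
    linarith
  have h0 : 0 ≤ ε * V := by positivity
  have h1 : μ ^ 2 * (h₁ ^ 2 + h₂ ^ 2 + (q * h₁ - p * h₂) ^ 2)
      = 2 * ((μ * h₁ - 2 * ε ^ 2 * x) ^ 2 + (μ * h₂ - 2 * ε ^ 2 * y) ^ 2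
        + (q * (μ * h₁ - 2 * ε ^ 2 * x) - p * (μ * h₂ - 2 * ε ^ 2 * y)) ^ 2)
      + 2 * ((2 * ε ^ 2 * x) ^ 2 + (2 * ε ^ 2 * y) ^ 2
        + (q * (2 * ε ^ 2 * x) - p * (2 * ε ^ 2 * y)) ^ 2)
      - ((μ * h₁ - 4 * ε ^ 2 * x) ^ 2 + (μ * h₂ - 4 * ε ^ 2 * y) ^ 2
        + (q * (μ * h₁ - 4 * ε ^ 2 * x) - p * (μ * h₂ - 4 * ε ^ 2 * y)) ^ 2) := by ring
  have h2 : 0 ≤ (μ * h₁ - 4 * ε ^ 2 * x) ^ 2 + (μ * h₂ - 4 * ε ^ 2 * y) ^ 2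
        + (q * (μ * h₁ - 4 * ε ^ 2 * x) - p * (μ * h₂ - 4 * ε ^ 2 * y)) ^ 2 := by positivity
  rw [h1]
  linarith

theorem exists_small_gradient {u : ℝ × ℝ → ℝ} (hu : ContDiff ℝ (⊤ : ℕ∞) u) {b₁ b₂ g : ℝ}
    (pde : ∀ x, (1 + (pdt u x) ^ 2) * pds (pds u) x - 2 * pds u x * pdt u x * pdt (pds u) x
      + (1 + (pds u x) ^ 2) * pdt (pdt u) x
      = (1 + (pds u x) ^ 2 + (pdt u x) ^ 2) * (g - pds u x * b₁ - pdt u x * b₂))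
    (hb : b₁ ^ 2 + b₂ ^ 2 ≤ 1) {a₀ b₀ v₀ w : ℝ} (horth : a₀ * b₁ + b₀ * b₂ + v₀ * g = 0)
    (hw : ∀ x : ℝ × ℝ, |a₀ * x.1 + b₀ * x.2 + v₀ * u x| ≤ w)
    {l₀ l₁ l₂ : ℝ} (hl : ∀ x, 0 < l₀ + l₁ * pds u x + l₂ * pdt u x)
    {μ ε : ℝ} (hμ : 0 < μ) (hμw : μ * w ≤ 1 / 2) (hε : 0 < ε) (hε' : ε ≤ 1) (P : ℝ × ℝ) :
    ∃ Q : ℝ × ℝ,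
      (1 - μ * w) ^ 2 *
          ((l₀ + l₁ * pds u Q + l₂ * pdt u Q) / √(1 + (pds u Q) ^ 2 + (pdt u Q) ^ 2))
        ≤ (1 + μ * w) ^ 2 *
          ((l₀ + l₁ * pds u P + l₂ * pdt u P) / √(1 + (pds u P) ^ 2 + (pdt u P) ^ 2)) ∧
      μ ^ 2 * ((a₀ + v₀ * pds u Q) ^ 2 + (b₀ + v₀ * pdt u Q) ^ 2
          + (pdt u Q * (a₀ + v₀ * pds u Q) - pds u Q * (b₀ + v₀ * pdt u Q)) ^ 2)
        ≤ 48 * ε * (1 + (pds u Q) ^ 2 + (pdt u Q) ^ 2) := by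
  have hp := contDiff_pds hu
  have hq := contDiff_pdt hu
  have Hu := hasPartials_of_contDiff hu
  have Hp := hasPartials_of_contDiff hp
  have Hq := hasPartials_of_contDiff hq
  rw [pds_pdt_comm hu] at Hq
  set p := pds u
  set q := pdt u
  set ℓ : ℝ × ℝ → ℝ := fun x => l₀ + l₁ * p x + l₂ * q x with hℓ
  set W : ℝ × ℝ → ℝ := fun x => √(1 + p x ^ 2 + q x ^ 2) with hW
  have hW0 : ∀ x, 0 < W x := fun x => Real.sqrt_pos.2 (by positivity)
  have hl : ∀ x, 0 < ℓ x := hl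
  have hℓc : Continuous ℓ :=
    (continuous_const.add (continuous_const.mul hp.continuous)).add
      (continuous_const.mul hq.continuous)
  have hWc : Continuous W :=
    ((continuous_const.add (hp.continuous.pow 2)).add (hq.continuous.pow 2)).sqrt
  have hμh : ∀ x : ℝ × ℝ, -(μ * w) ≤ μ * (a₀ * x.1 + b₀ * x.2 + v₀ * u x) ∧
      μ * (a₀ * x.1 + b₀ * x.2 + v₀ * u x) ≤ μ * w := fun x => by
    have := abs_le.1 (hw x)
    constructor <;> nlinarith
  -- the cut-off function
  set φ : ℝ × ℝ → ℝ := fun x => 1 + μ * (a₀ * x.1 + b₀ * x.2 + v₀ * u x)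
    - ε ^ 2 * ((x.1 - P.1) * (x.1 - P.1) + (x.2 - P.2) * (x.2 - P.2)) with hφ
  have X1 := HasPartials.fst.sub (HasPartials.const P.1)
  have X2 := HasPartials.snd.sub (HasPartials.const P.2)
  have Hφ : HasPartials φ (fun x => μ * (a₀ + v₀ * p x) - 2 * ε ^ 2 * (x.1 - P.1))
      (fun x => μ * (b₀ + v₀ * q x) - 2 * ε ^ 2 * (x.2 - P.2)) := by
    have := ((HasPartials.const 1).add ((((HasPartials.fst.const_mul a₀).add
      (HasPartials.snd.const_mul b₀)).add (Hu.const_mul v₀)).const_mul μ)).sub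
      (((X1.mul X1).add (X2.mul X2)).const_mul (ε ^ 2))
    convert this using 2 <;> ring
  have Hφ₁ : HasPartials (fun x => μ * (a₀ + v₀ * p x) - 2 * ε ^ 2 * (x.1 - P.1))
      (fun x => μ * (v₀ * pds p x) - 2 * ε ^ 2) (fun x => μ * (v₀ * pdt p x)) := by
    have := (((HasPartials.const a₀).add (Hp.const_mul v₀)).const_mul μ).sub
      (X1.const_mul (2 * ε ^ 2))
    convert this using 2 <;> ring
  have Hφ₂ : HasPartials (fun x => μ * (b₀ + v₀ * q x) - 2 * ε ^ 2 * (x.2 - P.2))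
      (fun x => μ * (v₀ * pdt p x)) (fun x => μ * (v₀ * pdt q x) - 2 * ε ^ 2) := by
    have := (((HasPartials.const b₀).add (Hq.const_mul v₀)).const_mul μ).sub
      (X2.const_mul (2 * ε ^ 2))
    convert this using 2 <;> ring
  have hφle : ∀ x, φ x ≤ 1 + μ * w - ε ^ 2 * ((x.1 - P.1) ^ 2 + (x.2 - P.2) ^ 2) := fun x => by
    have := (hμh x).2
    rw [hφ]; dsimp only; nlinarith
  have hφP : 1 - μ * w ≤ φ P := by
    have := (hμh P).1
    rw [hφ]; dsimp only; nlinarith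
  have hK : IsCompact {x | 0 ≤ φ x} := by
    refine Metric.isCompact_of_isClosed_isBounded
      (isClosed_le continuous_const Hφ.continuous) ?_
    refine (Metric.isBounded_closedBall (x := P) (r := 2 / ε)).subset fun x hx => ?_
    have h1 : ε ^ 2 * ((x.1 - P.1) ^ 2 + (x.2 - P.2) ^ 2) ≤ 2 ^ 2 := by
      have := hφle x
      have h0 : 0 ≤ φ x := hx
      linarith
    have h2 : ∀ d, ε ^ 2 * d ^ 2 ≤ 2 ^ 2 → |d| ≤ 2 / ε := fun d hd => by
      rw [le_div_iff₀ hε]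
      have : |d * ε| ≤ 2 := abs_le_of_sq_le_sq (by nlinarith) (by norm_num)
      rwa [abs_mul, abs_of_pos hε] at this
    rw [Metric.mem_closedBall, Prod.dist_eq, Real.dist_eq, Real.dist_eq]
    refine max_le (h2 _ ?_) (h2 _ ?_) <;> nlinarith [sq_nonneg (ε * (x.1 - P.1)), sq_nonneg (ε * (x.2 - P.2))]
  have hP : P ∈ {x | 0 ≤ φ x} := show 0 ≤ φ P by linarith
  have hFc : Continuous fun x => φ x * φ x * (W x / ℓ x) :=
    (Hφ.continuous.mul Hφ.continuous).mul (hWc.div hℓc fun x => (hl x).ne')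
  obtain ⟨Q, hQ, hmax⟩ := hK.exists_isMaxOn ⟨P, hP⟩ hFc.continuousOn
  have hFP : 0 < φ P * φ P * (W P / ℓ P) :=
    mul_pos (mul_pos (by linarith) (by linarith)) (div_pos (hW0 P) (hl P))
  have hPQ : φ P * φ P * (W P / ℓ P) ≤ φ Q * φ Q * (W Q / ℓ Q) := hmax hP
  set m := φ Q * φ Q * (W Q / ℓ Q) with hm
  have hm0 : 0 < m := hFP.trans_le hPQ
  have hQ0 : 0 < φ Q := by
    refine lt_of_le_of_ne hQ fun h => ?_
    exact hm0.ne' (by rw [hm, ← h, zero_mul, zero_mul])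
  have hmin : IsLocalMin (fun y => ℓ y - m⁻¹ * (φ y * φ y) * W y) Q := by
    have h0 : m⁻¹ * (φ Q * φ Q) * W Q = ℓ Q := by
      rw [hm]
      have := (hl Q).ne'
      have := (hW0 Q).ne'
      field_simp
    filter_upwards [(isOpen_lt continuous_const Hφ.continuous).mem_nhds hQ0] with y hy
    rw [h0, sub_self, sub_nonneg]
    have h1 : φ y * φ y * (W y / ℓ y) ≤ m := hmax (le_of_lt hy : 0 ≤ φ y)
    rw [← mul_div_assoc, div_le_iff₀ (hl y)] at h1
    rw [mul_assoc, inv_mul_le_iff₀ hm0]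
    exact h1
  have key := touching hu pde ((Hφ.mul Hφ).const_mul m⁻¹)
    (((Hφ₁.mul Hφ).add (Hφ.mul Hφ₁)).const_mul m⁻¹)
    (by
      have := ((Hφ₂.mul Hφ).add (Hφ.mul Hφ₂)).const_mul m⁻¹
      convert this using 2; ring)
    (mul_pos (inv_pos.2 hm0) (mul_pos hQ0 hQ0)) hmin
  have hφQ := hφle Q
  refine ⟨Q, ?_, ?_⟩
  · have h1 : (1 - μ * w) ^ 2 * (W P / ℓ P) ≤ (1 + μ * w) ^ 2 * (W Q / ℓ Q) := by
      have hPl := div_pos (hW0 P) (hl P)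
      have hQl := div_pos (hW0 Q) (hl Q)
      have h2 : (1 - μ * w) ^ 2 ≤ φ P * φ P := by
        rw [sq]; exact mul_self_le_mul_self (by linarith) hφP
      have h3 : φ Q * φ Q ≤ (1 + μ * w) ^ 2 := by
        rw [sq]; exact mul_self_le_mul_self hQ0.le (hφQ.trans (by
          have : 0 ≤ ε ^ 2 * ((Q.1 - P.1) ^ 2 + (Q.2 - P.2) ^ 2) := by positivity
          linarith))
      calc _ ≤ φ P * φ P * (W P / ℓ P) := by gcongr
        _ ≤ _ := hPQ
        _ ≤ _ := by rw [hm]; gcongr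
    have hA := hl Q
    have hB := hl P
    have hC := hW0 P
    have hD := hW0 Q
    change (1 - μ * w) ^ 2 * (ℓ Q / W Q) ≤ (1 + μ * w) ^ 2 * (ℓ P / W P)
    rw [← mul_div_assoc, ← mul_div_assoc, div_le_div_iff₀ (by assumption) (by assumption)] at h1 ⊢
    linarith
  · refine small_gradient_algebra (f := φ Q) (b₁ := b₁) (b₂ := b₂) (x := Q.1 - P.1)
      (y := Q.2 - P.2) hε hε' hQ0 ?_ hb ?_ ?_
    · have : 0 ≤ ε ^ 2 * ((Q.1 - P.1) ^ 2 + (Q.2 - P.2) ^ 2) := by positivity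
      linarith
    · linarith
    · have hpQ := pde Q
      refine le_of_mul_le_mul_left ?_ (mul_pos two_pos (inv_pos.2 hm0))
      linear_combination key - 2 * m⁻¹ * φ Q * μ * v₀ * hpQ
        - 2 * m⁻¹ * φ Q * μ * (1 + p Q ^ 2 + q Q ^ 2) * horth

theorem sq_combination_le (x y z l₀ l₁ l₂ : ℝ) :
    (l₀ * z - l₁ * x - l₂ * y) ^ 2 ≤ (x ^ 2 + y ^ 2 + z ^ 2) * (l₀ ^ 2 + l₁ ^ 2 + l₂ ^ 2) := by
  linarith [sq_nonneg (l₀ * x + l₁ * z), sq_nonneg (l₀ * y + l₂ * z), sq_nonneg (l₁ * y - l₂ * x)]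

theorem normal_near_algebra {k κ l n D L : ℝ} (hk : 0 < k) (hkκ : k ≤ κ) (hκ : κ < l)
    (hn : n ^ 2 = 1 - D) (hD : 0 ≤ D) (hn1 : n ≤ 1) (hc : (k - n * l) ^ 2 ≤ D * L)
    (hD1 : D * (2 * l) ≤ l - κ) (hD2 : D * L < ((l - κ) / 2) ^ 2) : False := by
  have hl : 0 < l := by linarith
  have h1 : (l - κ) / 2 ≤ |k - n * l| := by
    rcases le_total n 0 with h | h
    · have hn' : 1 - D ≤ -n := by
        by_contra! hcon
        nlinarith
      have := mul_le_mul_of_nonneg_right hn' hl.le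
      rw [abs_of_nonneg (by nlinarith)]
      nlinarith
    · have hn' : 1 - D ≤ n := by nlinarith
      have := mul_le_mul_of_nonneg_right hn' hl.le
      refine le_trans ?_ (neg_le_abs _)
      nlinarith
  have h2 : ((l - κ) / 2) ^ 2 ≤ (k - n * l) ^ 2 := by
    rw [← sq_abs (k - n * l)]
    exact pow_le_pow_left₀ (by linarith) h1 2
  linarith

theorem normal_near_contradiction {p q W a₀ b₀ v₀ l₀ l₁ l₂ l κ δ : ℝ} (hW0 : 0 < W)
    (hWsq : W ^ 2 = 1 + p ^ 2 + q ^ 2) (hunit : a₀ ^ 2 + b₀ ^ 2 + v₀ ^ 2 = 1)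
    (hl : l = l₀ * v₀ - l₁ * a₀ - l₂ * b₀) (hlpos : 0 < l₀ + l₁ * p + l₂ * q)
    (hkκ : (l₀ + l₁ * p + l₂ * q) / W ≤ κ) (hκ0 : 0 < κ) (hκl : κ < l)
    (hgrad : (a₀ + v₀ * p) ^ 2 + (b₀ + v₀ * q) ^ 2
      + (q * (a₀ + v₀ * p) - p * (b₀ + v₀ * q)) ^ 2 ≤ δ * W ^ 2)
    (hδ : δ * (2 * l) ≤ l - κ)
    (hδ' : δ * (l₀ ^ 2 + l₁ ^ 2 + l₂ ^ 2) < ((l - κ) / 2) ^ 2) : False := by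
  set n := (v₀ - a₀ * p - b₀ * q) / W with hn
  have hnW : n * W = v₀ - a₀ * p - b₀ * q := div_mul_cancel₀ _ hW0.ne'
  set kQ := (l₀ + l₁ * p + l₂ * q) / W with hkQ
  have hkW : kQ * W = l₀ + l₁ * p + l₂ * q := div_mul_cancel₀ _ hW0.ne'
  have hDW : (1 - n ^ 2) * W ^ 2 = (a₀ + v₀ * p) ^ 2 + (b₀ + v₀ * q) ^ 2
      + (q * (a₀ + v₀ * p) - p * (b₀ + v₀ * q)) ^ 2 := by
    linear_combination hWsq - (n * W + v₀ - a₀ * p - b₀ * q) * hnW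
      - (1 + p ^ 2 + q ^ 2) * hunit
  have hD0 : 0 ≤ 1 - n ^ 2 := by
    by_contra! h
    have h1 : (1 - n ^ 2) * W ^ 2 < 0 := mul_neg_of_neg_of_pos h (by positivity)
    rw [hDW] at h1
    exact absurd h1 (not_lt.2 (by positivity))
  have hD : 1 - n ^ 2 ≤ δ := by
    rw [← hDW] at hgrad
    exact le_of_mul_le_mul_right hgrad (by positivity)
  have hc : (kQ - n * l) ^ 2 ≤ (1 - n ^ 2) * (l₀ ^ 2 + l₁ ^ 2 + l₂ ^ 2) := by
    set z := 1 / W - n * v₀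
    set x := -p / W - n * a₀
    set y := -q / W - n * b₀
    have h1 : kQ - n * l = l₀ * z - l₁ * x - l₂ * y := by
      rw [hkQ, hl]
      simp only [z, x, y]
      ring
    have h2 : x ^ 2 + y ^ 2 + z ^ 2 = 1 - n ^ 2 := by
      have e1 : W * z = 1 - n * W * v₀ := by simp only [z]; field_simp
      have e2 : W * x = -p - n * W * a₀ := by simp only [x]; field_simp
      have e3 : W * y = -q - n * W * b₀ := by simp only [y]; field_simp
      have : W ^ 2 * (x ^ 2 + y ^ 2 + z ^ 2) = W ^ 2 * (1 - n ^ 2) := by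
        linear_combination (W * z + 1 - n * W * v₀) * e1 + (W * x - p - n * W * a₀) * e2
          + (W * y - q - n * W * b₀) * e3 - hWsq + 2 * n * W * hnW + n ^ 2 * W ^ 2 * hunit
      exact mul_left_cancel₀ (by positivity) this
    rw [h1, ← h2]
    exact sq_combination_le x y z l₀ l₁ l₂
  exact normal_near_algebra (div_pos hlpos hW0) hkκ hκl (by ring) hD0 (by nlinarith) hc
    ((mul_le_mul_of_nonneg_right hD (by linarith)).trans hδ)
    ((mul_le_mul_of_nonneg_right hD (by positivity)).trans_lt hδ')

/-- If a fixed vector has positive inner product with the normal of the graph everywhere, then that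
inner product is at least the one of the vector with the (unit) bounded direction. -/
theorem mul_le_of_pos {u : ℝ × ℝ → ℝ} (hu : ContDiff ℝ (⊤ : ℕ∞) u) {b₁ b₂ g : ℝ}
    (pde : ∀ x, (1 + (pdt u x) ^ 2) * pds (pds u) x - 2 * pds u x * pdt u x * pdt (pds u) x
      + (1 + (pds u x) ^ 2) * pdt (pdt u) x
      = (1 + (pds u x) ^ 2 + (pdt u x) ^ 2) * (g - pds u x * b₁ - pdt u x * b₂))
    (hb : b₁ ^ 2 + b₂ ^ 2 ≤ 1) {a₀ b₀ v₀ w : ℝ} (horth : a₀ * b₁ + b₀ * b₂ + v₀ * g = 0)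
    (hunit : a₀ ^ 2 + b₀ ^ 2 + v₀ ^ 2 = 1)
    (hw : ∀ x : ℝ × ℝ, |a₀ * x.1 + b₀ * x.2 + v₀ * u x| ≤ w)
    {l₀ l₁ l₂ : ℝ} (hl : ∀ x, 0 < l₀ + l₁ * pds u x + l₂ * pdt u x) (P : ℝ × ℝ) :
    (l₀ * v₀ - l₁ * a₀ - l₂ * b₀) * √(1 + (pds u P) ^ 2 + (pdt u P) ^ 2)
      ≤ l₀ + l₁ * pds u P + l₂ * pdt u P := by
  by_contra! hcon
  set l := l₀ * v₀ - l₁ * a₀ - l₂ * b₀ with hldef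
  have hWP : 0 < √(1 + (pds u P) ^ 2 + (pdt u P) ^ 2) := Real.sqrt_pos.2 (by positivity)
  set k := (l₀ + l₁ * pds u P + l₂ * pdt u P) / √(1 + (pds u P) ^ 2 + (pdt u P) ^ 2) with hk
  have hk0 : 0 < k := div_pos (hl P) hWP
  have hkl : k < l := by rwa [hk, div_lt_iff₀ hWP]
  set κ := (k + l) / 2 with hκ
  have hκl : κ < l := by linarith
  obtain ⟨μ, hμ0, hμw, hμ⟩ : ∃ μ : ℝ, 0 < μ ∧ μ * w ≤ 1 / 2 ∧
      (1 + μ * w) ^ 2 * k ≤ (1 - μ * w) ^ 2 * κ := by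
    have h1 : Filter.Tendsto (fun μ : ℝ => (1 - μ * w) ^ 2 * κ - (1 + μ * w) ^ 2 * k)
        (nhdsWithin 0 (Set.Ioi 0)) (nhds (κ - k)) := by
      have : Continuous (fun μ : ℝ => (1 - μ * w) ^ 2 * κ - (1 + μ * w) ^ 2 * k) := by fun_prop
      simpa using (this.tendsto 0).mono_left nhdsWithin_le_nhds
    have h2 : Filter.Tendsto (fun μ : ℝ => μ * w) (nhdsWithin 0 (Set.Ioi 0)) (nhds 0) := by
      have : Continuous (fun μ : ℝ => μ * w) := by fun_prop
      simpa using (this.tendsto 0).mono_left nhdsWithin_le_nhds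
    have h3 := h1.eventually (lt_mem_nhds (show 0 < κ - k by linarith))
    have h4 := h2.eventually (gt_mem_nhds (show (0 : ℝ) < 1 / 2 by norm_num))
    obtain ⟨μ, ⟨h5, h6⟩, h7⟩ := ((h3.and h4).and self_mem_nhdsWithin).exists
    exact ⟨μ, h7, h6.le, by linarith⟩
  set L := l₀ ^ 2 + l₁ ^ 2 + l₂ ^ 2 with hL
  have hL0 : 0 ≤ L := by positivity
  obtain ⟨ε, hε0, hε1, hεa, hεb⟩ : ∃ ε : ℝ, 0 < ε ∧ ε ≤ 1 ∧
      48 * ε / μ ^ 2 * (2 * l) ≤ l - κ ∧ 48 * ε / μ ^ 2 * L < ((l - κ) / 2) ^ 2 := by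
    have h1 : ∀ c : ℝ, Filter.Tendsto (fun ε : ℝ => 48 * ε / μ ^ 2 * c)
        (nhdsWithin 0 (Set.Ioi 0)) (nhds 0) := fun c => by
      have : Continuous (fun ε : ℝ => 48 * ε / μ ^ 2 * c) := by fun_prop
      simpa using (this.tendsto 0).mono_left nhdsWithin_le_nhds
    have h2 := (h1 (2 * l)).eventually (gt_mem_nhds (show 0 < l - κ by linarith))
    have h3 := (h1 L).eventually (gt_mem_nhds (show 0 < ((l - κ) / 2) ^ 2 by
      have : 0 < l - κ := by linarith
      positivity))
    have h4 : ∀ᶠ ε : ℝ in nhdsWithin 0 (Set.Ioi 0), ε < 1 :=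
      nhdsWithin_le_nhds (gt_mem_nhds one_pos)
    obtain ⟨ε, ⟨⟨h5, h6⟩, h7⟩, h8⟩ := (((h2.and h3).and h4).and self_mem_nhdsWithin).exists
    exact ⟨ε, h8, h7.le, h5.le, h6⟩
  obtain ⟨Q, hQ1, hQ2⟩ := exists_small_gradient hu pde hb horth hw hl hμ0 hμw hε0 hε1 P
  have h1 : 0 < (1 - μ * w) ^ 2 := pow_pos (by linarith) 2
  have hWsq := Real.sq_sqrt (by positivity : 0 ≤ 1 + pds u Q ^ 2 + pdt u Q ^ 2)
  refine normal_near_contradiction (Real.sqrt_pos.2 (by positivity)) hWsq hunit hldef (hl Q)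
    (le_of_mul_le_mul_left (hQ1.trans hμ) h1) (by linarith) hκl ?_ hεa hεb
  rw [hWsq, div_mul_eq_mul_div, le_div_iff₀ (by positivity)]
  linarith

/-- A bounded linear coordinate of an entire translating graph, transverse to the graph direction
and orthogonal to the translation direction, is constant. -/
theorem const_of_bounded {u : ℝ × ℝ → ℝ} (hu : ContDiff ℝ (⊤ : ℕ∞) u) {b₁ b₂ g : ℝ}
    (pde : ∀ x, (1 + (pdt u x) ^ 2) * pds (pds u) x - 2 * pds u x * pdt u x * pdt (pds u) x
      + (1 + (pds u x) ^ 2) * pdt (pdt u) x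
      = (1 + (pds u x) ^ 2 + (pdt u x) ^ 2) * (g - pds u x * b₁ - pdt u x * b₂))
    (hb : b₁ ^ 2 + b₂ ^ 2 ≤ 1) {a₀ b₀ v₀ w : ℝ} (horth : a₀ * b₁ + b₀ * b₂ + v₀ * g = 0)
    (hunit : a₀ ^ 2 + b₀ ^ 2 + v₀ ^ 2 = 1) (hv : 0 < v₀)
    (hw : ∀ x : ℝ × ℝ, |a₀ * x.1 + b₀ * x.2 + v₀ * u x| ≤ w) :
    ∃ c : ℝ, ∀ x : ℝ × ℝ, a₀ * x.1 + b₀ * x.2 + v₀ * u x = c := by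
  set W : ℝ × ℝ → ℝ := fun x => √(1 + (pds u x) ^ 2 + (pdt u x) ^ 2) with hW
  set N : ℝ × ℝ → ℝ := fun x => v₀ - a₀ * pds u x - b₀ * pdt u x with hN
  have hW0 : ∀ x, 0 < W x := fun x => Real.sqrt_pos.2 (by positivity)
  have hWsq : ∀ x, W x ^ 2 = 1 + pds u x ^ 2 + pdt u x ^ 2 := fun x => Real.sq_sqrt (by positivity)
  have hWN : ∀ x, W x ^ 2 - N x ^ 2 = (a₀ + v₀ * pds u x) ^ 2 + (b₀ + v₀ * pdt u x) ^ 2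
      + (pdt u x * (a₀ + v₀ * pds u x) - pds u x * (b₀ + v₀ * pdt u x)) ^ 2 := fun x => by
    rw [hWsq, hN]
    linear_combination - (1 + pds u x ^ 2 + pdt u x ^ 2) * hunit
  have hNW : ∀ x, |N x| ≤ W x := fun x => by
    refine abs_le_of_sq_le_sq ?_ (hW0 x).le
    have : 0 ≤ W x ^ 2 - N x ^ 2 := by rw [hWN]; positivity
    linarith
  have hstep : ∀ τ : ℝ, (∀ x, 0 < 1 + τ * N x) → ∀ x, (v₀ + τ) * W x ≤ 1 + τ * N x := by
    intro τ hτ x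
    have := mul_le_of_pos hu pde hb horth hunit hw (l₀ := 1 + τ * v₀) (l₁ := -(τ * a₀))
      (l₂ := -(τ * b₀)) (fun y => by have := hτ y; simp only [hN] at this; linarith) x
    have h1 : (1 + τ * v₀) * v₀ - -(τ * a₀) * a₀ - -(τ * b₀) * b₀ = v₀ + τ := by
      linear_combination τ * hunit
    rw [h1] at this
    simp only [hN]
    change (v₀ + τ) * W x ≤ _ at this
    linarith
  have hpos : ∀ n : ℕ, ∀ x, 0 < 1 + (n * (v₀ / 2)) * N x := by
    intro n
    induction n with
    | zero => intro x; simp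
    | succ n ih =>
      intro x
      have h1 := hstep _ ih x
      have h2 := (abs_le.1 (hNW x)).1
      have h3 : 0 ≤ n * (v₀ / 2) * W x := by have := (hW0 x).le; positivity
      have h4 : 0 < v₀ * W x := mul_pos hv (hW0 x)
      push_cast
      nlinarith
  have hle : ∀ x, W x ≤ N x := by
    intro x
    by_contra! hlt
    obtain ⟨n, hn⟩ := exists_nat_gt (1 / (v₀ / 2 * (W x - N x)))
    have h1 : 0 < v₀ / 2 * (W x - N x) := mul_pos (by linarith) (by linarith)
    rw [div_lt_iff₀ h1] at hn
    have h2 := hstep _ (hpos n) x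
    have h4 : 0 < v₀ * W x := mul_pos hv (hW0 x)
    linarith
  have hgrad : ∀ x, a₀ + v₀ * pds u x = 0 ∧ b₀ + v₀ * pdt u x = 0 := by
    intro x
    have h1 : W x ^ 2 ≤ N x ^ 2 := pow_le_pow_left₀ (hW0 x).le (hle x) 2
    have h2 := hWN x
    have h3 := sq_nonneg (a₀ + v₀ * pds u x)
    have h4 := sq_nonneg (b₀ + v₀ * pdt u x)
    have h5 := sq_nonneg (pdt u x * (a₀ + v₀ * pds u x) - pds u x * (b₀ + v₀ * pdt u x))
    exact ⟨pow_eq_zero_iff (two_ne_zero) |>.1 (by linarith),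
      pow_eq_zero_iff (two_ne_zero) |>.1 (by linarith)⟩
  have H := ((HasPartials.fst.const_mul a₀).add (HasPartials.snd.const_mul b₀)).add
    ((hasPartials_of_contDiff hu).const_mul v₀)
  refine ⟨_, fun x => is_const_of_fderiv_eq_zero (𝕜 := ℝ) (fun y => (H y).differentiableAt)
    (fun y => ?_) x 0⟩
  rw [(H y).fderiv]
  obtain ⟨h1, h2⟩ := hgrad y
  have h1' : a₀ * 1 + b₀ * 0 + v₀ * pds u y = 0 := by linarith
  have h2' : a₀ * 0 + b₀ * 1 + v₀ * pdt u y = 0 := by linarith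
  simp only [h1', h2', zero_smul, add_zero]

theorem orthonormal_columns {a b v : E3} (ha : ‖a‖ = 1) (hb : ‖b‖ = 1) (hv : ‖v‖ = 1)
    (hab : ⟪a, b⟫ = 0) (hav : ⟪a, v⟫ = 0) (hbv : ⟪b, v⟫ = 0) (i j : Fin 3) :
    a i * a j + b i * b j + v i * v j = if i = j then 1 else 0 := by
  have haa : ⟪a, a⟫ = 1 := by rw [real_inner_self_eq_norm_sq, ha, one_pow]
  have hbb : ⟪b, b⟫ = 1 := by rw [real_inner_self_eq_norm_sq, hb, one_pow]
  have hvv : ⟪v, v⟫ = 1 := by rw [real_inner_self_eq_norm_sq, hv, one_pow]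
  rw [PiLp.inner_apply, Fin.sum_univ_three] at haa hbb hvv hab hav hbv
  simp only [RCLike.inner_apply, conj_trivial] at haa hbb hvv hab hav hbv
  have h : (!![a 0, a 1, a 2; b 0, b 1, b 2; v 0, v 1, v 2] : Matrix (Fin 3) (Fin 3) ℝ)
      * !![a 0, b 0, v 0; a 1, b 1, v 1; a 2, b 2, v 2] = 1 := by
    ext i j
    fin_cases i <;> fin_cases j <;> simp [Matrix.mul_apply, Fin.sum_univ_three] <;> linarith
  have h' := congrArg (fun M : Matrix (Fin 3) (Fin 3) ℝ => M i j) (mul_eq_one_comm.1 h)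
  dsimp only at h'
  rw [Matrix.one_apply] at h'
  rw [← h']
  fin_cases i <;> fin_cases j <;> simp [Matrix.mul_apply, Fin.sum_univ_three]

theorem graph_coords_injective {a b v : E3} (ha : ‖a‖ = 1) (hb : ‖b‖ = 1)
    (hab : ⟪a, b⟫ = 0) (hav : ⟪a, v⟫ = 0) (hbv : ⟪b, v⟫ = 0) {s t r s' t' r' : ℝ}
    (h : s • a + t • b + r • v = s' • a + t' • b + r' • v) : s = s' ∧ t = t' := by
  have haa : ⟪a, a⟫ = 1 := by rw [real_inner_self_eq_norm_sq, ha, one_pow]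
  have hbb : ⟪b, b⟫ = 1 := by rw [real_inner_self_eq_norm_sq, hb, one_pow]
  have hba : ⟪b, a⟫ = 0 := by rw [real_inner_comm, hab]
  have h1 := congrArg (fun q => ⟪a, q⟫) h
  have h2 := congrArg (fun q => ⟪b, q⟫) h
  simp only [inner_add_right, inner_smul_right, haa, hbb, hab, hba, hav, hbv] at h1 h2
  constructor <;> linarith

/-- A closed translating graph in a slab transverse to the graph direction is entire. -/
theorem IsTranslatingGraph.dom_eq_univ {a b v : E3} {Ω : Set (ℝ × ℝ)} {u : ℝ × ℝ → ℝ} {S : Set E3}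
    (hgraph : IsTranslatingGraph a b v Ω u S) (hcomplete : IsClosed S) (hv : v 0 ≠ 0) {w : ℝ}
    (hw : ∀ p ∈ Ω, |a 0 * p.1 + b 0 * p.2 + v 0 * u p| ≤ w) : Ω = Set.univ := by
  refine IsClopen.eq_univ (s := Ω) ⟨?_, hgraph.isOpen_dom⟩ hgraph.isConnected_dom.nonempty
  refine isClosed_of_closure_subset fun p hp => ?_
  obtain ⟨x, hxΩ, hx⟩ := mem_closure_iff_seq_limit.1 hp
  have hx1 : Filter.Tendsto (fun n => (x n).1) Filter.atTop (nhds p.1) :=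
    (continuous_fst.tendsto p).comp hx
  have hx2 : Filter.Tendsto (fun n => (x n).2) Filter.atTop (nhds p.2) :=
    (continuous_snd.tendsto p).comp hx
  have hbdd : Bornology.IsBounded (Set.range fun n => a 0 * (x n).1 + b 0 * (x n).2 + v 0 * u (x n)) := by
    refine (Metric.isBounded_closedBall (x := (0 : ℝ)) (r := w)).subset ?_
    rintro _ ⟨n, rfl⟩
    rw [Metric.mem_closedBall, Real.dist_eq, sub_zero]
    exact hw _ (hxΩ n)
  obtain ⟨c, -, φ, hφ, hc⟩ := tendsto_subseq_of_bounded hbdd fun n => Set.mem_range_self n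
  have hφ1 := hx1.comp hφ.tendsto_atTop
  have hφ2 := hx2.comp hφ.tendsto_atTop
  have hu : Filter.Tendsto (fun n => u (x (φ n))) Filter.atTop
      (nhds ((c - a 0 * p.1 - b 0 * p.2) / v 0)) := by
    have := ((hc.sub (hφ1.const_mul (a 0))).sub (hφ2.const_mul (b 0))).div_const (v 0)
    refine this.congr fun n => ?_
    simp only [Function.comp_apply]
    field_simp
    ring
  have hlim := ((hφ1.smul_const a).add (hφ2.smul_const b)).add (hu.smul_const v)
  have hmem := hcomplete.mem_of_tendsto hlim (Filter.Eventually.of_forall fun n => by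
    rw [hgraph.graph_eq]
    exact ⟨x (φ n), hxΩ _, rfl⟩)
  rw [hgraph.graph_eq] at hmem
  obtain ⟨p', hp', h⟩ := hmem
  obtain ⟨h1, h2⟩ := graph_coords_injective hgraph.norm_a hgraph.norm_b hgraph.inner_ab
    hgraph.inner_av hgraph.inner_bv h
  rwa [Prod.ext h1 h2]

/-- A complete connected translating graph in a direction `v` with `⟪v, e₁⟫ ≠ 0`,
contained in a slab `{|x| ≤ w}`, is a vertical plane `{x = x₀}`. -/
theorem stmt0 (a b v : E3) (Ω : Set (ℝ × ℝ)) (u : ℝ × ℝ → ℝ) (S : Set E3)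
    (hgraph : IsTranslatingGraph a b v Ω u S) (hcomplete : IsClosed S)
    (hv : ⟪v, e1⟫ ≠ 0) (w : ℝ) (hw : 0 < w)
    (hslab : S ⊆ {q : E3 | |q 0| ≤ w}) :
    ∃ x₀ : ℝ, S = {q : E3 | q 0 = x₀} := by
  have hcol := orthonormal_columns hgraph.norm_a hgraph.norm_b hgraph.norm_v hgraph.inner_ab
    hgraph.inner_av hgraph.inner_bv
  have hv0 : v 0 ≠ 0 := by simpa [e1, PiLp.inner_apply, Fin.sum_univ_three] using hv
  have h3 : ∀ q : E3, ⟪e3, q⟫ = q 2 := fun q => by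
    simp [e3, PiLp.inner_apply, Fin.sum_univ_three]
  have hslab' : ∀ p ∈ Ω, |a 0 * p.1 + b 0 * p.2 + v 0 * u p| ≤ w := fun p hp => by
    have : p.1 • a + p.2 • b + u p • v ∈ S := by
      rw [hgraph.graph_eq]; exact ⟨p, hp, rfl⟩
    simpa [mul_comm] using hslab this
  obtain rfl := hgraph.dom_eq_univ hcomplete hv0 hslab'
  have hu := contDiffOn_univ.1 hgraph.smooth
  have hpde := fun p => hgraph.pde p (Set.mem_univ p)
  simp only [h3] at hpde
  have h00 := hcol 0 0
  have h02 := hcol 0 2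
  have h22 := hcol 2 2
  simp only [if_true] at h00 h22
  rw [if_neg (by decide)] at h02
  have hb : a 2 ^ 2 + b 2 ^ 2 ≤ 1 := by nlinarith [sq_nonneg (v 2)]
  obtain ⟨c, hc⟩ : ∃ c : ℝ, ∀ x : ℝ × ℝ, a 0 * x.1 + b 0 * x.2 + v 0 * u x = c := by
    rcases lt_or_gt_of_ne hv0 with hneg | hpos
    · obtain ⟨c, hc⟩ := const_of_bounded hu hpde hb (a₀ := -a 0) (b₀ := -b 0) (v₀ := -v 0) (w := w)
        (by linarith) (by linarith) (by linarith) (fun x => by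
          rw [← abs_neg]
          convert hslab' x (Set.mem_univ x) using 2
          ring)
      exact ⟨-c, fun x => by linarith [hc x]⟩
    · exact const_of_bounded hu hpde hb h02 (by linarith) hpos fun x => hslab' x (Set.mem_univ x)
  refine ⟨c, ?_⟩
  rw [hgraph.graph_eq]
  ext q
  constructor
  · rintro ⟨p, -, rfl⟩
    simpa [mul_comm] using hc p
  · intro hq
    have hq : q 0 = c := hq
    have hexp : ∀ i, q i = ⟪a, q⟫ * a i + ⟪b, q⟫ * b i + ⟪v, q⟫ * v i := fun i => by
      simp only [PiLp.inner_apply, Fin.sum_univ_three, RCLike.inner_apply, conj_trivial]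
      have e0 := hcol i 0
      have e1 := hcol i 1
      have e2 := hcol i 2
      have : q i = q 0 * (if i = 0 then 1 else 0) + q 1 * (if i = 1 then 1 else 0)
          + q 2 * (if i = 2 then 1 else 0) := by
        fin_cases i <;> simp
      rw [← e0, ← e1, ← e2] at this
      linarith
    have hup : u (⟪a, q⟫, ⟪b, q⟫) = ⟪v, q⟫ := by
      have h1 := hc (⟪a, q⟫, ⟪b, q⟫)
      have h2 := hexp 0
      refine mul_left_cancel₀ hv0 ?_
      dsimp only at h1
      linarith
    refine ⟨(⟪a, q⟫, ⟪b, q⟫), Set.mem_univ _, ?_⟩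
    rw [hup]
    ext i
    simpa using hexp i
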